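/- Sol decomposes as the direct sum Sol = Im(Φ_{p,q→x}) ⊕ Ker(Φ_{x→p,q}): every f ∈ Sol can be written uniquely as f = Φ_{p,q→x}(h) + k with h ∈ Sol′ and Φ_{x→p,q}(k) = 0. Consequently, the composition ActY ∘ Φ_{p,q→x} is a vector-space isomorphism from Sol′ onto the image of ActY (the algebra QΛ of quasi-symmetric functions on Young diagrams). -/

import Mathlib

open MvPolynomial

/-- Sequences of polynomials: the `n`-th term is thought of as a polynomial in
`x_1, …, x_n` (variable `j : ℕ` corresponds to `x_{j+1}`). -/
abbrev PolySeq : Type := (n : ℕ) → MvPolynomial ℕ ℂ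

/-- The algebra morphism substituting `0` for the variable `x_{n+1}` (index `n`). -/
noncomputable def killVar (n : ℕ) : MvPolynomial ℕ ℂ →ₐ[ℂ] MvPolynomial ℕ ℂ :=
  aeval (fun j => if j = n then 0 else X j)

/-- `f` is a *stable polynomial*: `f n` only involves `x_1, …, x_n` and setting the last
variable of `f (n+1)` to zero gives back `f n`. -/
def IsStable (f : PolySeq) : Prop :=
  (∀ n, f n ∈ supported ℂ (Set.Iio n)) ∧ ∀ n, killVar n (f (n + 1)) = f n

/-- The substitution `x_{j+2} := x_{j+1}` (0-based : variable `j+1` is replaced by variable `j`). -/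
noncomputable def collapse (j : ℕ) : MvPolynomial ℕ ℂ →ₐ[ℂ] MvPolynomial ℕ ℂ :=
  aeval (fun k => if k = j + 1 then X j else X k)

/-- Renaming of variables skipping the two indices `j`, `j+1`. -/
noncomputable def skip2 (j : ℕ) : MvPolynomial ℕ ℂ →ₐ[ℂ] MvPolynomial ℕ ℂ :=
  rename (fun k => if k < j then k else k + 2)

/-- The functional equation (1) of the paper: substituting `x_{i+1} = x_i` in `f_n` yields
`f_{n-2} (x_1, …, x_{i-1}, x_{i+2}, …, x_n)`. -/
def IsSol (f : PolySeq) : Prop :=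
  IsStable f ∧ ∀ n j : ℕ, j + 2 ≤ n → collapse j (f n) = skip2 j (f (n - 2))

/-- Homogeneity of degree `d` for a stable polynomial. -/
def IsHomogSeq (f : PolySeq) (d : ℕ) : Prop := ∀ n, (f n).IsHomogeneous d

private lemma homog_smul {p : MvPolynomial ℕ ℂ} {d : ℕ} (c : ℂ) (h : p.IsHomogeneous d) :
    (c • p).IsHomogeneous d := by
  rw [smul_eq_C_mul]
  simpa using (isHomogeneous_C ℕ c).mul h

/-- The homogeneous component of degree `d` of the space of solutions of the
functional equation, as a `ℂ`-vector space. -/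
noncomputable def SolHomog (d : ℕ) : Submodule ℂ PolySeq where
  carrier := {f | IsSol f ∧ IsHomogSeq f d}
  zero_mem' := by
    refine ⟨⟨⟨fun n => Subalgebra.zero_mem _, fun n => by simp only [Pi.zero_apply, map_zero]⟩,
      fun n j _ => by simp only [Pi.zero_apply, map_zero]⟩, fun n => isHomogeneous_zero _ _ _⟩
  add_mem' := by
    rintro a b ⟨⟨⟨ha1, ha2⟩, ha3⟩, ha4⟩ ⟨⟨⟨hb1, hb2⟩, hb3⟩, hb4⟩
    refine ⟨⟨⟨fun n => Subalgebra.add_mem _ (ha1 n) (hb1 n), fun n => ?_⟩, fun n j h => ?_⟩,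
      fun n => (ha4 n).add (hb4 n)⟩
    · simp only [Pi.add_apply, map_add, ha2 n, hb2 n]
    · simp only [Pi.add_apply, map_add, ha3 n j h, hb3 n j h]
  smul_mem' := by
    rintro c a ⟨⟨⟨ha1, ha2⟩, ha3⟩, ha4⟩
    refine ⟨⟨⟨fun n => Subalgebra.smul_mem _ (ha1 n) c, fun n => ?_⟩, fun n j h => ?_⟩,
      fun n => homog_smul c (ha4 n)⟩
    · simp only [Pi.smul_apply, map_smul, ha2 n]
    · simp only [Pi.smul_apply, map_smul, ha3 n j h]

/-- The lists of interlacing (Kerov) coordinates of Young diagrams: strictly decreasing integer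
sequences `x_1 > … > x_{2m+1}` (recorded as a function `ℕ → ℤ` together with `m`; 0-based
indices) whose alternating sum `∑_{i=1}^{2m+1} (-1)^i x_i` vanishes. -/
def Interlacing : Type :=
  {xm : (ℕ → ℤ) × ℕ // (∀ i, i + 1 ≤ 2 * xm.2 → xm.1 (i + 1) < xm.1 i) ∧
    (∑ j ∈ Finset.range (2 * xm.2 + 1), (-1 : ℤ) ^ j * xm.1 j) = 0}

/-- The evaluation map sending a stable polynomial to the function it defines on lists of
interlacing coordinates (i.e. on Young diagrams). -/
noncomputable def ActY : PolySeq →ₗ[ℂ] (Interlacing → ℂ) where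
  toFun f := fun x => aeval (fun j => ((x.1.1 j : ℤ) : ℂ)) (f (2 * x.1.2 + 1))
  map_add' f g := by funext x; exact map_add (aeval _) _ _
  map_smul' c f := by funext x; exact map_smul (aeval (R := ℂ) _) c _

/-- Polynomials in the two families of (commuting) variables `p_1, p_2, …` (`Sum.inl`, 0-based)
and `q_1, q_2, …` (`Sum.inr`, 0-based). -/
abbrev PQPoly : Type := MvPolynomial (ℕ ⊕ ℕ) ℂ

/-- Sequences of polynomials, the `m`-th term being thought of as a polynomial in
`p_1, …, p_m, q_1, …, q_m`. -/
abbrev PQSeq : Type := (m : ℕ) → PQPoly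

/-- The variables `p_1, …, p_m, q_1, …, q_m`. -/
def pqVars (m : ℕ) : Set (ℕ ⊕ ℕ) := Sum.inl '' Set.Iio m ∪ Sum.inr '' Set.Iio m

/-- Substituting `0` for both `p_{m+1}` and `q_{m+1}` (0-based index `m`). -/
noncomputable def killPQ (m : ℕ) : PQPoly →ₐ[ℂ] PQPoly :=
  aeval (Sum.elim (fun k => if k = m then 0 else X (Sum.inl k))
    (fun k => if k = m then 0 else X (Sum.inr k)))

/-- `h` is a two-alphabet stable polynomial. -/
def IsStablePQ (h : PQSeq) : Prop :=
  (∀ m, h m ∈ supported ℂ (pqVars m)) ∧ ∀ m, killPQ m (h (m + 1)) = h m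

/-- Substituting `0` for the variable `v0`. -/
noncomputable def subst0PQ (v0 : ℕ ⊕ ℕ) : PQPoly →ₐ[ℂ] PQPoly :=
  aeval (fun v => if v = v0 then 0 else X v)

/-- The substitution describing the right-hand side of equation (EqQZero) : the parts
`p_{j+1}` and `p_{j+2}` are merged (`0`-based : `p_j`, `p_{j+1}`) and `q_{j+1}` is removed. -/
noncomputable def mergeP (j : ℕ) : PQPoly →ₐ[ℂ] PQPoly :=
  aeval (Sum.elim
    (fun k => if k < j then X (Sum.inl k)
      else if k = j then X (Sum.inl j) + X (Sum.inl (j + 1)) else X (Sum.inl (k + 1)))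
    (fun k => if k < j then X (Sum.inr k) else X (Sum.inr (k + 1))))

/-- The substitution describing the right-hand side of equation (EqPZero) : `p_{j+1}`
(0-based `p_j`, `1 ≤ j`) is removed and the parts `q_{j-1}`, `q_j` (0-based) are merged. -/
noncomputable def mergeQ (j : ℕ) : PQPoly →ₐ[ℂ] PQPoly :=
  aeval (Sum.elim
    (fun k => if k < j then X (Sum.inl k) else X (Sum.inl (k + 1)))
    (fun k => if k + 1 < j then X (Sum.inr k)
      else if k + 1 = j then X (Sum.inr k) + X (Sum.inr (k + 1)) else X (Sum.inr (k + 1))))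

/-- The shift substitution, for the case `p_1 = 0` of equation (EqPZero). -/
noncomputable def shiftPQ : PQPoly →ₐ[ℂ] PQPoly :=
  aeval (Sum.elim (fun k => X (Sum.inl (k + 1))) (fun k => X (Sum.inr (k + 1))))

/-- The system of equations (EqQZero)-(EqPZero) defining `Sol'`: a two alphabet stable
polynomial whose components take the same values on any two multirectangular descriptions of
a Young diagram. -/
def IsSolPQ (h : PQSeq) : Prop :=
  IsStablePQ h ∧
  (∀ m j, j + 2 ≤ m → subst0PQ (Sum.inr j) (h m) = mergeP j (h (m - 1))) ∧
  (∀ m, 1 ≤ m → subst0PQ (Sum.inr (m - 1)) (h m) = h (m - 1)) ∧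
  (∀ m j, 1 ≤ j → j + 1 ≤ m → subst0PQ (Sum.inl j) (h m) = mergeQ j (h (m - 1))) ∧
  (∀ m, 1 ≤ m → subst0PQ (Sum.inl 0) (h m) = shiftPQ (h (m - 1)))

/-- The polynomial expression of the interlacing coordinate `x_{t+1}` (0-based index `t`)
in terms of multirectangular coordinates:
`x_{2i+1} = (q_{i+1} + … + q_m) - (p_1 + … + p_i)` and
`x_{2i} = (q_i + … + q_m) - (p_1 + … + p_i)`. -/
noncomputable def xExpr (m t : ℕ) : PQPoly :=
  (∑ k ∈ Finset.Ico (if t % 2 = 0 then (t + 1) / 2 else (t + 1) / 2 - 1) m, X (Sum.inr k))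
    - ∑ k ∈ Finset.range ((t + 1) / 2), X (Sum.inl k)

/-- The change of variables `Φ_{x → p,q}` from interlacing to multirectangular coordinates. -/
noncomputable def PhiXtoPQ (f : PolySeq) : PQSeq :=
  fun m => aeval (xExpr m) (f (2 * m + 1))

/-- The multirectangular coordinates in terms of interlacing coordinates:
`p_i = x_{2i-1} - x_{2i}` and `q_i = x_{2i} - x_{2i+1}` (all 0-based here). -/
noncomputable def pqExpr : (ℕ ⊕ ℕ) → MvPolynomial ℕ ℂ :=
  Sum.elim (fun k => X (2 * k) - X (2 * k + 1)) (fun k => X (2 * k + 1) - X (2 * k + 2))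

/-- The change of variables `Φ_{p,q → x}` from multirectangular to interlacing coordinates. -/
noncomputable def PhiPQtoX (h : PQSeq) : PolySeq :=
  fun n => if n % 2 = 1 then aeval pqExpr (h (n / 2))
    else killVar n (aeval pqExpr (h (n / 2)))

section Evaluation

variable {R : Type*} [CommRing R] [Algebra ℂ R]

lemma aeval_congr_of_mem_supported {σ : Type*} {s : Set σ} {a b : σ → R}
    {p : MvPolynomial σ ℂ} (hp : p ∈ supported ℂ s) (hab : ∀ i ∈ s, a i = b i) :
    aeval a p = aeval b p :=
  eval₂Hom_congr' rfl (fun i hi _ => hab i (mem_supported.mp hp hi)) rfl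

lemma aeval_killVar {a : ℕ → R} {n : ℕ} (h : a n = 0) (p : MvPolynomial ℕ ℂ) :
    aeval a (killVar n p) = aeval a p := by
  rw [killVar, comp_aeval_apply]
  congr 2
  funext k
  by_cases hk : k = n <;> simp [hk, h]

lemma aeval_subst0PQ {a : ℕ ⊕ ℕ → R} {v : ℕ ⊕ ℕ} (h : a v = 0) (p : PQPoly) :
    aeval a (subst0PQ v p) = aeval a p := by
  rw [subst0PQ, comp_aeval_apply]
  congr 2
  funext k
  by_cases hk : k = v <;> simp [hk, h]

lemma IsSol.aeval_eq {f : PolySeq} (hf : IsSol f) {n j : ℕ} (hj : j + 2 ≤ n) {a : ℕ → R}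
    (ha : a j = a (j + 1)) :
    aeval a (f n) = aeval (fun k => a (if k < j then k else k + 2)) (f (n - 2)) := by
  have h := congrArg (aeval a) (hf.2 n j hj)
  rw [skip2, aeval_rename, collapse, comp_aeval_apply] at h
  rw [Function.comp_def] at h
  rw [← h]
  congr 2
  funext k
  by_cases hk : k = j + 1 <;> simp [hk, ha]

/-- The `t`-th interlacing coordinate (0-based) attached to multirectangular coordinates
`p_0, …, p_{m-1}` and `q_0, …, q_{m-1}`. -/
def interlacingCoord (p q : ℕ → R) (m t : ℕ) : R :=
  ∑ k ∈ Finset.range m, q k - ∑ k ∈ Finset.range (t / 2), q k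
    - ∑ k ∈ Finset.range ((t + 1) / 2), p k

lemma map_xExpr (φ : PQPoly →ₐ[ℂ] R) {m t : ℕ} (ht : t ≤ 2 * m) :
    φ (xExpr m t) =
      interlacingCoord (fun k => φ (X (Sum.inl k))) (fun k => φ (X (Sum.inr k))) m t := by
  have h : (if t % 2 = 0 then (t + 1) / 2 else (t + 1) / 2 - 1) = t / 2 := by
    split_ifs <;> omega
  rw [xExpr, h, interlacingCoord, Finset.sum_Ico_eq_sub _ (by omega : t / 2 ≤ m)]
  simp only [map_sub, map_sum]

lemma aeval_PhiXtoPQ {f : PolySeq} (hf : IsSol f) (φ : PQPoly →ₐ[ℂ] R) (m : ℕ) :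
    φ (PhiXtoPQ f m) = aeval (interlacingCoord (fun k => φ (X (Sum.inl k)))
      (fun k => φ (X (Sum.inr k))) m) (f (2 * m + 1)) := by
  rw [PhiXtoPQ, comp_aeval_apply]
  exact aeval_congr_of_mem_supported (hf.1.1 _)
    fun t ht => map_xExpr φ (by simp at ht; omega)

end Evaluation

section PartialSums

variable {R : Type*} [AddCommMonoid R]

lemma sum_range_merge (u : ℕ → R) (j s : ℕ) :
    ∑ k ∈ Finset.range s,
        (if k < j then u k else if k = j then u j + u (j + 1) else u (k + 1)) =
      if s ≤ j then ∑ k ∈ Finset.range s, u k else ∑ k ∈ Finset.range (s + 1), u k := by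
  induction s with
  | zero => simp
  | succ s ih =>
    rw [Finset.sum_range_succ, ih]
    rcases lt_trichotomy s j with h | rfl | h
    · simp [h, h.le, Nat.succ_le_of_lt h, Finset.sum_range_succ]
    · simp [Finset.sum_range_succ, add_assoc]
    · simp [h.not_ge, h.not_gt, h.ne', Finset.sum_range_succ]

lemma sum_range_skip (u : ℕ → R) {j : ℕ} (hj : u j = 0) (s : ℕ) :
    ∑ k ∈ Finset.range s, (if k < j then u k else u (k + 1)) =
      if s ≤ j then ∑ k ∈ Finset.range s, u k else ∑ k ∈ Finset.range (s + 1), u k := by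
  rw [← sum_range_merge]
  refine Finset.sum_congr rfl fun k _ => ?_
  split_ifs with h₁ h₂
  · rfl
  · rw [h₂, hj, zero_add]
  · rfl

end PartialSums

lemma aeval_mem_of_mem_supported {σ R : Type*} [CommRing R] [Algebra ℂ R] {s : Set σ}
    {a : σ → R} {p : MvPolynomial σ ℂ} (hp : p ∈ supported ℂ s) {S : Subalgebra ℂ R}
    (ha : ∀ i ∈ s, a i ∈ S) : aeval a p ∈ S := by
  have h : supported ℂ s ≤ S.comap (aeval a) := by
    refine Algebra.adjoin_le ?_
    rintro _ ⟨i, hi, rfl⟩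
    simpa using ha i hi
  exact h hp

section InterlacingCoord

variable {R : Type*} [CommRing R]

lemma interlacingCoord_eq_succ_of_q_eq_zero {p q : ℕ → R} {j : ℕ} (hq : q j = 0) (m : ℕ) :
    interlacingCoord p q m (2 * j + 1) = interlacingCoord p q m (2 * j + 1 + 1) := by
  simp [interlacingCoord, (by omega : (2 * j + 1) / 2 = j),
    (by omega : (2 * j + 1 + 1) / 2 = j + 1),
    (by omega : (2 * j + 1 + 1 + 1) / 2 = j + 1), Finset.sum_range_succ, hq]

lemma interlacingCoord_eq_succ_of_p_eq_zero {p q : ℕ → R} {j : ℕ} (hp : p j = 0) (m : ℕ) :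
    interlacingCoord p q m (2 * j) = interlacingCoord p q m (2 * j + 1) := by
  simp [interlacingCoord, (by omega : (2 * j + 1) / 2 = j),
    (by omega : (2 * j + 1 + 1) / 2 = j + 1),
    Finset.sum_range_succ, hp]

lemma interlacingCoord_mergeP {p q : ℕ → R} {m j : ℕ} (hj : j + 2 ≤ m) (hq : q j = 0) (t : ℕ) :
    interlacingCoord
        (fun k => if k < j then p k else if k = j then p j + p (j + 1) else p (k + 1))
        (fun k => if k < j then q k else q (k + 1)) (m - 1) t =
      interlacingCoord p q m (if t < 2 * j + 1 then t else t + 2) := by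
  obtain ⟨m, rfl⟩ : ∃ n, m = n + 1 := ⟨m - 1, by omega⟩
  simp only [interlacingCoord, sum_range_merge, sum_range_skip q hq, Nat.add_sub_cancel,
    if_neg (by omega : ¬ m ≤ j)]
  split_ifs with h₁ h₂ h₃ <;> try omega
  · rfl
  · obtain rfl : t / 2 = j := by omega
    rw [(by omega : (t + 2) / 2 = t / 2 + 1), (by omega : (t + 2 + 1) / 2 = (t + 1) / 2 + 1),
      Finset.sum_range_succ _ (t / 2), hq, add_zero]
  · rw [(by omega : (t + 2) / 2 = t / 2 + 1), (by omega : (t + 2 + 1) / 2 = (t + 1) / 2 + 1)]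

lemma interlacingCoord_of_last_q_eq_zero {p q : ℕ → R} {m : ℕ} (hm : 1 ≤ m)
    (hq : q (m - 1) = 0) {t : ℕ} (ht : t < 2 * (m - 1) + 1) :
    interlacingCoord p q (m - 1) t =
      interlacingCoord p q m (if t < 2 * (m - 1) + 1 then t else t + 2) := by
  obtain ⟨m, rfl⟩ : ∃ n, m = n + 1 := ⟨m - 1, by omega⟩
  rw [if_pos ht]
  simp only [Nat.add_sub_cancel] at hq ⊢
  simp [interlacingCoord, Finset.sum_range_succ, hq]

lemma interlacingCoord_mergeQ {p q : ℕ → R} {m j : ℕ} (hj₁ : 1 ≤ j) (hj : j + 1 ≤ m)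
    (hp : p j = 0) (t : ℕ) :
    interlacingCoord (fun k => if k < j then p k else p (k + 1))
        (fun k => if k + 1 < j then q k else if k + 1 = j then q k + q (k + 1) else q (k + 1))
        (m - 1) t =
      interlacingCoord p q m (if t < 2 * j then t else t + 2) := by
  obtain ⟨m, rfl⟩ : ∃ n, m = n + 1 := ⟨m - 1, by omega⟩
  obtain ⟨j, rfl⟩ : ∃ n, j = n + 1 := ⟨j - 1, by omega⟩
  have hq (s : ℕ) : ∑ k ∈ Finset.range s,
      (if k + 1 < j + 1 then q k else if k + 1 = j + 1 then q k + q (k + 1) else q (k + 1)) =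
      if s ≤ j then ∑ k ∈ Finset.range s, q k else ∑ k ∈ Finset.range (s + 1), q k := by
    rw [← sum_range_merge]
    refine Finset.sum_congr rfl fun k _ => ?_
    simp only [add_lt_add_iff_right, add_left_inj]
    split_ifs with h₁ h₂
    · rfl
    · rw [h₂]
    · rfl
  simp only [interlacingCoord, hq, sum_range_skip p hp, Nat.add_sub_cancel,
    if_neg (by omega : ¬ m ≤ j)]
  split_ifs with h₁ h₂ h₃ <;> try omega
  · rfl
  · rw [(by omega : (t + 2) / 2 = t / 2 + 1), (by omega : (t + 2 + 1) / 2 = (t + 1) / 2 + 1),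
      (by omega : (t + 1) / 2 = j + 1), Finset.sum_range_succ p (j + 1), hp, add_zero]
  · rw [(by omega : (t + 2) / 2 = t / 2 + 1), (by omega : (t + 2 + 1) / 2 = (t + 1) / 2 + 1)]

lemma interlacingCoord_shift {p q : ℕ → R} {m : ℕ} (hm : 1 ≤ m) (hp : p 0 = 0) (t : ℕ) :
    interlacingCoord (fun k => p (k + 1)) (fun k => q (k + 1)) (m - 1) t =
      interlacingCoord p q m (if t < 2 * 0 then t else t + 2) := by
  obtain ⟨m, rfl⟩ : ∃ n, m = n + 1 := ⟨m - 1, by omega⟩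
  simp [interlacingCoord, (by omega : (t + 2) / 2 = t / 2 + 1),
    (by omega : (t + 2 + 1) / 2 = (t + 1) / 2 + 1), Finset.sum_range_succ', hp]

end InterlacingCoord

lemma IsSol.map_PhiXtoPQ_eq {f : PolySeq} (hf : IsSol f) {m j : ℕ} (hj : j + 2 ≤ 2 * m + 1)
    (φ ψ : PQPoly →ₐ[ℂ] PQPoly)
    (hφ : interlacingCoord (fun k => φ (X (Sum.inl k))) (fun k => φ (X (Sum.inr k))) m j =
      interlacingCoord (fun k => φ (X (Sum.inl k))) (fun k => φ (X (Sum.inr k))) m (j + 1))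
    (hψ : ∀ t < 2 * (m - 1) + 1,
      interlacingCoord (fun k => ψ (X (Sum.inl k))) (fun k => ψ (X (Sum.inr k))) (m - 1) t =
      interlacingCoord (fun k => φ (X (Sum.inl k))) (fun k => φ (X (Sum.inr k))) m
        (if t < j then t else t + 2)) :
    φ (PhiXtoPQ f m) = ψ (PhiXtoPQ f (m - 1)) := by
  rw [aeval_PhiXtoPQ hf, aeval_PhiXtoPQ hf, hf.aeval_eq hj hφ,
    (by omega : 2 * m + 1 - 2 = 2 * (m - 1) + 1)]
  exact aeval_congr_of_mem_supported (hf.1.1 _) fun t ht => (hψ t ht).symm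

lemma inl_mem_pqVars {k m : ℕ} : Sum.inl k ∈ pqVars m ↔ k < m := by simp [pqVars]

lemma inr_mem_pqVars {k m : ℕ} : Sum.inr k ∈ pqVars m ↔ k < m := by simp [pqVars]

lemma IsSol.PhiXtoPQ_mem_supported {f : PolySeq} (hf : IsSol f) (m : ℕ) :
    PhiXtoPQ f m ∈ supported ℂ (pqVars m) := by
  refine aeval_mem_of_mem_supported (hf.1.1 _) fun t ht => ?_
  simp only [Set.mem_Iio] at ht
  refine sub_mem (sum_mem fun k hk => ?_) (sum_mem fun k hk => ?_)
  · exact X_mem_supported.2 (inr_mem_pqVars.2 (Finset.mem_Ico.1 hk).2)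
  · refine X_mem_supported.2 (inl_mem_pqVars.2 ?_)
    have := Finset.mem_range.1 hk
    omega

lemma killPQ_eq (m : ℕ) (p : PQPoly) :
    killPQ m p = subst0PQ (Sum.inl m) (subst0PQ (Sum.inr m) p) := by
  rw [killPQ, subst0PQ, subst0PQ, comp_aeval_apply]
  congr 2
  funext v
  rcases v with k | k <;> by_cases hk : k = m <;> simp [hk]

lemma subst0PQ_of_notMem {s : Set (ℕ ⊕ ℕ)} {v : ℕ ⊕ ℕ} {p : PQPoly} (hp : p ∈ supported ℂ s)
    (hv : v ∉ s) : subst0PQ v p = p := by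
  conv_rhs => rw [← aeval_X_left_apply p]
  refine aeval_congr_of_mem_supported hp fun i hi => if_neg ?_
  rintro rfl
  exact hv hi

lemma IsSol.subst0PQ_last_PhiXtoPQ {f : PolySeq} (hf : IsSol f) {m : ℕ} (hm : 1 ≤ m) :
    subst0PQ (Sum.inr (m - 1)) (PhiXtoPQ f m) = PhiXtoPQ f (m - 1) := by
  have hq : subst0PQ (Sum.inr (m - 1)) (X (Sum.inr (m - 1))) = 0 := by simp [subst0PQ]
  rw [← subst0PQ_of_notMem (v := Sum.inr (m - 1)) (hf.PhiXtoPQ_mem_supported (m - 1))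
    (by simp [inr_mem_pqVars])]
  exact hf.map_PhiXtoPQ_eq (j := 2 * (m - 1) + 1) (by omega) _ _
    (interlacingCoord_eq_succ_of_q_eq_zero hq m)
    fun t ht => interlacingCoord_of_last_q_eq_zero hm hq ht

lemma IsSol.isSolPQ_PhiXtoPQ {f : PolySeq} (hf : IsSol f) : IsSolPQ (PhiXtoPQ f) := by
  refine ⟨⟨hf.PhiXtoPQ_mem_supported, fun m => ?_⟩, fun m j hj => ?_,
    fun m hm => hf.subst0PQ_last_PhiXtoPQ hm, fun m j hj₁ hj => ?_, fun m hm => ?_⟩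
  · have h := hf.subst0PQ_last_PhiXtoPQ (m := m + 1) (by omega)
    rw [Nat.add_sub_cancel] at h
    rw [killPQ_eq, h]
    exact subst0PQ_of_notMem (hf.PhiXtoPQ_mem_supported m) (by simp [inl_mem_pqVars])
  · have hq : subst0PQ (Sum.inr j) (X (Sum.inr j)) = 0 := by simp [subst0PQ]
    refine hf.map_PhiXtoPQ_eq (j := 2 * j + 1) (by omega) _ _
      (interlacingCoord_eq_succ_of_q_eq_zero hq m) fun t _ => ?_
    rw [← interlacingCoord_mergeP hj hq]
    refine congrArg₂ (fun p q => interlacingCoord p q (m - 1) t) ?_ ?_ <;>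
      (funext k; simp only [subst0PQ, mergeP, aeval_X, Sum.elim_inl, Sum.elim_inr, reduceCtorEq,
        if_false, Sum.inr.injEq] <;> split_ifs <;> first | rfl | omega)
  · have hp : subst0PQ (Sum.inl j) (X (Sum.inl j)) = 0 := by simp [subst0PQ]
    refine hf.map_PhiXtoPQ_eq (j := 2 * j) (by omega) _ _
      (interlacingCoord_eq_succ_of_p_eq_zero hp m) fun t _ => ?_
    rw [← interlacingCoord_mergeQ hj₁ hj hp]
    refine congrArg₂ (fun p q => interlacingCoord p q (m - 1) t) ?_ ?_ <;>
      (funext k; simp only [subst0PQ, mergeQ, aeval_X, Sum.elim_inl, Sum.elim_inr, reduceCtorEq,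
        if_false, Sum.inl.injEq] <;> split_ifs <;> first | rfl | omega)
  · have hp : subst0PQ (Sum.inl 0) (X (Sum.inl 0)) = 0 := by simp [subst0PQ]
    refine hf.map_PhiXtoPQ_eq (j := 2 * 0) (by omega) _ _
      (interlacingCoord_eq_succ_of_p_eq_zero hp m) fun t _ => ?_
    rw [← interlacingCoord_shift hm hp]
    refine congrArg₂ (fun p q => interlacingCoord p q (m - 1) t) ?_ ?_ <;> funext k <;>
      simp [subst0PQ, shiftPQ]

lemma PhiPQtoX_odd (h : PQSeq) (m : ℕ) : PhiPQtoX h (2 * m + 1) = aeval pqExpr (h m) := by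
  simp only [PhiPQtoX]
  rw [if_pos (by omega), (by omega : (2 * m + 1) / 2 = m)]

lemma PhiPQtoX_even (h : PQSeq) (m : ℕ) :
    PhiPQtoX h (2 * m) = killVar (2 * m) (PhiPQtoX h (2 * m + 1)) := by
  rw [PhiPQtoX_odd]
  simp only [PhiPQtoX]
  rw [if_neg (by omega), (by omega : 2 * m / 2 = m)]

lemma IsSolPQ.mem_supported_PhiPQtoX_odd {h : PQSeq} (hh : IsSolPQ h) (m : ℕ) :
    PhiPQtoX h (2 * m + 1) ∈ supported ℂ (Set.Iio (2 * m + 1)) := by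
  rw [PhiPQtoX_odd]
  refine aeval_mem_of_mem_supported (hh.1.1 m) ?_
  rintro (k | k) hk
  · rw [inl_mem_pqVars] at hk
    exact sub_mem (X_mem_supported.2 (by simp; omega)) (X_mem_supported.2 (by simp; omega))
  · rw [inr_mem_pqVars] at hk
    exact sub_mem (X_mem_supported.2 (by simp; omega)) (X_mem_supported.2 (by simp; omega))

lemma killVar_mem_supported {n : ℕ} {p : MvPolynomial ℕ ℂ}
    (hp : p ∈ supported ℂ (Set.Iio (n + 1))) : killVar n p ∈ supported ℂ (Set.Iio n) := by
  refine aeval_mem_of_mem_supported hp fun i hi => ?_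
  split_ifs with h
  · exact zero_mem _
  · refine X_mem_supported.2 ?_
    simp only [Set.mem_Iio] at hi ⊢
    omega

lemma IsSolPQ.mem_supported_PhiPQtoX {h : PQSeq} (hh : IsSolPQ h) (n : ℕ) :
    PhiPQtoX h n ∈ supported ℂ (Set.Iio n) := by
  obtain ⟨m, rfl | rfl⟩ := n.even_or_odd'
  · rw [PhiPQtoX_even]
    exact killVar_mem_supported (hh.mem_supported_PhiPQtoX_odd m)
  · exact hh.mem_supported_PhiPQtoX_odd m

lemma IsSolPQ.killVar_PhiPQtoX {h : PQSeq} (hh : IsSolPQ h) (n : ℕ) :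
    killVar n (PhiPQtoX h (n + 1)) = PhiPQtoX h n := by
  obtain ⟨m, rfl | rfl⟩ := n.even_or_odd'
  · exact (PhiPQtoX_even h m).symm
  · rw [(by ring : 2 * m + 1 + 1 = 2 * (m + 1)), PhiPQtoX_even, PhiPQtoX_odd, PhiPQtoX_odd,
      comp_aeval_apply, comp_aeval_apply, ← aeval_subst0PQ (v := Sum.inr m)]
    · have h₁ := hh.2.2.1 (m + 1) (by omega)
      rw [Nat.add_sub_cancel] at h₁
      rw [h₁]
      refine aeval_congr_of_mem_supported (hh.1.1 m) ?_
      rintro (k | k) hk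
      · rw [inl_mem_pqVars] at hk
        simp (disch := omega) [pqExpr, killVar, if_neg]
      · rw [inr_mem_pqVars] at hk
        simp (disch := omega) [pqExpr, killVar, if_neg]
    · simp [pqExpr, killVar, mul_add]

lemma IsSolPQ.collapse_PhiPQtoX_odd {h : PQSeq} (hh : IsSolPQ h) {m j : ℕ}
    (hj : j + 2 ≤ 2 * m + 1) :
    collapse j (PhiPQtoX h (2 * m + 1)) = skip2 j (PhiPQtoX h (2 * (m - 1) + 1)) := by
  rw [PhiPQtoX_odd, PhiPQtoX_odd, comp_aeval_apply, comp_aeval_apply]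
  obtain ⟨i, rfl | rfl⟩ := j.even_or_odd'
  · rw [← aeval_subst0PQ (v := Sum.inl i)]
    · rcases Nat.eq_zero_or_pos i with rfl | hi
      · rw [hh.2.2.2.2 m (by omega), shiftPQ, comp_aeval_apply]
        congr 2
        funext v
        rcases v with k | k
        · simp [pqExpr, collapse, skip2, mul_add]
        · simp [pqExpr, collapse, skip2, mul_add]
      · rw [hh.2.2.2.1 m i hi (by omega), mergeQ, comp_aeval_apply]
        congr 2
        funext v
        rcases v with k | k
        · simp only [pqExpr, collapse, skip2, Sum.elim_inl, map_sub, rename_X]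
          split_ifs <;> simp <;> grind
        · simp only [pqExpr, collapse, skip2, Sum.elim_inr, map_sub, rename_X]
          split_ifs <;> simp <;> grind
    · simp [pqExpr, collapse]
  · rw [← aeval_subst0PQ (v := Sum.inr i)]
    · by_cases hi : i + 2 ≤ m
      · rw [hh.2.1 m i hi, mergeP, comp_aeval_apply]
        congr 2
        funext v
        rcases v with k | k
        · simp only [pqExpr, collapse, skip2, Sum.elim_inl, map_sub, rename_X]
          split_ifs <;> simp <;> grind
        · simp only [pqExpr, collapse, skip2, Sum.elim_inr, map_sub, rename_X]
          split_ifs <;> simp <;> grind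
      · obtain rfl : i = m - 1 := by omega
        rw [hh.2.2.1 m (by omega)]
        refine aeval_congr_of_mem_supported (hh.1.1 _) ?_
        rintro (k | k) hk
        · rw [inl_mem_pqVars] at hk
          simp (disch := omega) [pqExpr, collapse, skip2, if_neg, if_pos]
        · rw [inr_mem_pqVars] at hk
          simp (disch := omega) [pqExpr, collapse, skip2, if_neg, if_pos]
    · simp [pqExpr, collapse]

lemma collapse_killVar {n j : ℕ} (hj : j + 2 ≤ n) (p : MvPolynomial ℕ ℂ) :
    collapse j (killVar n p) = killVar n (collapse j p) := by
  simp only [collapse, killVar, comp_aeval_apply]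
  congr 2
  funext k
  split_ifs <;> simp <;> grind

lemma skip2_killVar {n j : ℕ} (hj : j ≤ n) (p : MvPolynomial ℕ ℂ) :
    skip2 j (killVar n p) = killVar (n + 2) (skip2 j p) := by
  simp only [skip2, killVar, comp_aeval_apply, aeval_rename]
  congr 2
  funext k
  simp only [Function.comp_apply]
  split_ifs <;> simp <;> grind

lemma IsSolPQ.isSol_PhiPQtoX {h : PQSeq} (hh : IsSolPQ h) : IsSol (PhiPQtoX h) := by
  refine ⟨⟨hh.mem_supported_PhiPQtoX, hh.killVar_PhiPQtoX⟩, fun n j hj => ?_⟩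
  obtain ⟨m, rfl | rfl⟩ := n.even_or_odd'
  · rw [(by omega : 2 * m - 2 = 2 * (m - 1)), PhiPQtoX_even, PhiPQtoX_even, collapse_killVar hj,
      hh.collapse_PhiPQtoX_odd (by omega), skip2_killVar (by omega),
      (by omega : 2 * (m - 1) + 2 = 2 * m)]
  · rw [(by omega : 2 * m + 1 - 2 = 2 * (m - 1) + 1)]
    exact hh.collapse_PhiPQtoX_odd hj

lemma interlacingCoord_sub_succ_of_even {R : Type*} [CommRing R] (p q : ℕ → R) (m k : ℕ) :
    interlacingCoord p q m (2 * k) - interlacingCoord p q m (2 * k + 1) = p k := by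
  simp [interlacingCoord, (by omega : (2 * k + 1) / 2 = k),
    (by omega : (2 * k + 1 + 1) / 2 = k + 1), Finset.sum_range_succ]

lemma interlacingCoord_sub_succ_of_odd {R : Type*} [CommRing R] (p q : ℕ → R) (m k : ℕ) :
    interlacingCoord p q m (2 * k + 1) - interlacingCoord p q m (2 * k + 2) = q k := by
  simp [interlacingCoord, (by omega : (2 * k + 1) / 2 = k), (by omega : (2 * k + 2) / 2 = k + 1),
    (by omega : (2 * k + 2 + 1) / 2 = k + 1), Finset.sum_range_succ]

/-- Evaluating `Φ_{p,q → x}(h)` at the interlacing coordinates attached to `p, q`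
gives back the value of `h` at `p, q`. -/
lemma aeval_interlacingCoord_PhiPQtoX {R : Type*} [CommRing R] [Algebra ℂ R] (h : PQSeq)
    (p q : ℕ → R) (m : ℕ) :
    aeval (interlacingCoord p q m) (PhiPQtoX h (2 * m + 1)) = aeval (Sum.elim p q) (h m) := by
  rw [PhiPQtoX_odd, comp_aeval_apply]
  congr 2
  funext v
  rcases v with k | k
  · simp [pqExpr, interlacingCoord_sub_succ_of_even]
  · simp [pqExpr, interlacingCoord_sub_succ_of_odd]

lemma IsSolPQ.PhiXtoPQ_PhiPQtoX {h : PQSeq} (hh : IsSolPQ h) : PhiXtoPQ (PhiPQtoX h) = h := by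
  funext m
  rw [← AlgHom.id_apply (R := ℂ) (PhiXtoPQ (PhiPQtoX h) m), aeval_PhiXtoPQ hh.isSol_PhiPQtoX,
    aeval_interlacingCoord_PhiPQtoX]
  conv_rhs => rw [← aeval_X_left_apply (h m)]
  congr 2
  funext v
  rcases v with k | k <;> rfl

lemma IsSol.sub {f g : PolySeq} (hf : IsSol f) (hg : IsSol g) : IsSol (f - g) := by
  refine ⟨⟨fun n => sub_mem (hf.1.1 n) (hg.1.1 n), fun n => ?_⟩, fun n j hj => ?_⟩
  · simp only [Pi.sub_apply, map_sub, hf.1.2, hg.1.2]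
  · simp only [Pi.sub_apply, map_sub, hf.2 n j hj, hg.2 n j hj]

lemma PhiXtoPQ_add (f g : PolySeq) : PhiXtoPQ (f + g) = PhiXtoPQ f + PhiXtoPQ g := by
  funext m
  simp [PhiXtoPQ]

lemma PhiXtoPQ_sub (f g : PolySeq) : PhiXtoPQ (f - g) = PhiXtoPQ f - PhiXtoPQ g := by
  funext m
  simp [PhiXtoPQ]

lemma PhiPQtoX_add (h₁ h₂ : PQSeq) : PhiPQtoX (h₁ + h₂) = PhiPQtoX h₁ + PhiPQtoX h₂ := by
  funext n
  simp only [PhiPQtoX, Pi.add_apply, map_add]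
  split_ifs <;> rfl

lemma PhiPQtoX_smul (c : ℂ) (h : PQSeq) : PhiPQtoX (c • h) = c • PhiPQtoX h := by
  funext n
  simp only [PhiPQtoX, Pi.smul_apply, map_smul]
  split_ifs <;> rfl

lemma alternating_sum_eq {R : Type*} [CommRing R] (x : ℕ → R) (m : ℕ) :
    ∑ j ∈ Finset.range (2 * m + 1), (-1 : R) ^ j * x j =
      ∑ k ∈ Finset.range m, (x (2 * k) - x (2 * k + 1)) + x (2 * m) := by
  induction m with
  | zero => simp
  | succ m ih =>
    rw [(by ring : 2 * (m + 1) + 1 = 2 * m + 1 + 1 + 1), Finset.sum_range_succ,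
      Finset.sum_range_succ, ih, Finset.sum_range_succ]
    simp only [pow_succ, pow_mul, mul_add]
    ring_nf

lemma alternating_sum_interlacingCoord {R : Type*} [CommRing R] (p q : ℕ → R) (m : ℕ) :
    ∑ j ∈ Finset.range (2 * m + 1), (-1 : R) ^ j * interlacingCoord p q m j = 0 := by
  rw [alternating_sum_eq]
  simp only [interlacingCoord_sub_succ_of_even]
  simp [interlacingCoord, (by omega : (2 * m + 1) / 2 = m)]

/-- Interlacing coordinates with vanishing alternating sum are recovered from the
multirectangular coordinates they define. -/
lemma interlacingCoord_differences {R : Type*} [CommRing R] {x : ℕ → R} {m : ℕ}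
    (hx : ∑ j ∈ Finset.range (2 * m + 1), (-1 : R) ^ j * x j = 0) (t : ℕ) :
    interlacingCoord (fun k => x (2 * k) - x (2 * k + 1))
      (fun k => x (2 * k + 1) - x (2 * k + 2)) m t = x t := by
  have h (t : ℕ) : ∑ k ∈ Finset.range (t / 2), (x (2 * k + 1) - x (2 * k + 2)) +
      ∑ k ∈ Finset.range ((t + 1) / 2), (x (2 * k) - x (2 * k + 1)) = x 0 - x t := by
    induction t with
    | zero => simp
    | succ t ih =>
      obtain ⟨k, rfl | rfl⟩ := t.even_or_odd'
      · rw [(by omega : 2 * k / 2 = k), (by omega : (2 * k + 1) / 2 = k)] at ih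
        rw [(by omega : (2 * k + 1) / 2 = k), (by omega : (2 * k + 1 + 1) / 2 = k + 1),
          Finset.sum_range_succ _ k]
        linear_combination ih
      · rw [(by omega : (2 * k + 1) / 2 = k), (by omega : (2 * k + 1 + 1) / 2 = k + 1)] at ih
        rw [(by omega : (2 * k + 1 + 1) / 2 = k + 1), (by omega : (2 * k + 1 + 1 + 1) / 2 = k + 1),
          Finset.sum_range_succ _ k]
        linear_combination ih
  have hm := h (2 * m)
  rw [(by omega : 2 * m / 2 = m), (by omega : (2 * m + 1) / 2 = m)] at hm
  rw [alternating_sum_eq] at hx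
  rw [interlacingCoord]
  linear_combination hm - h t - hx

lemma map_interlacingCoord {R S : Type*} [CommRing R] [CommRing S] (φ : R →+* S) (p q : ℕ → R)
    (m t : ℕ) : φ (interlacingCoord p q m t) =
      interlacingCoord (fun k => φ (p k)) (fun k => φ (q k)) m t := by
  simp [interlacingCoord]

/-- The Young diagram, in interlacing coordinates, with given positive multirectangular
coordinates. -/
def Interlacing.ofPQ (p q : ℕ → ℤ) (hp : ∀ k, 0 < p k) (hq : ∀ k, 0 < q k) (m : ℕ) :
    Interlacing :=
  ⟨(interlacingCoord p q m, m), fun i _ => by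
    obtain ⟨k, rfl | rfl⟩ := i.even_or_odd'
    · have := interlacingCoord_sub_succ_of_even p q m k
      have := hp k
      simp only
      omega
    · have : interlacingCoord p q m (2 * k + 1) - interlacingCoord p q m (2 * k + 1 + 1) = q k :=
        interlacingCoord_sub_succ_of_odd p q m k
      have := hq k
      simp only
      omega, alternating_sum_interlacingCoord p q m⟩

lemma ActY_PhiPQtoX_ofPQ (h : PQSeq) {p q : ℕ → ℤ} (hp : ∀ k, 0 < p k) (hq : ∀ k, 0 < q k)
    (m : ℕ) : ActY (PhiPQtoX h) (Interlacing.ofPQ p q hp hq m) =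
      aeval (Sum.elim (fun k => (p k : ℂ)) (fun k => (q k : ℂ))) (h m) := by
  rw [← aeval_interlacingCoord_PhiPQtoX]
  refine congrArg (fun a : ℕ → ℂ => aeval a (PhiPQtoX h (2 * m + 1))) ?_
  funext t
  exact map_interlacingCoord (Int.castRingHom ℂ) p q m t

lemma ActY_PhiPQtoX_injective : Function.Injective fun h => ActY (PhiPQtoX h) := by
  intro h₁ h₂ h
  funext m
  refine funext_set (fun _ => Set.range fun n : ℕ => ((n : ℂ) + 1)) (fun _ => ?_) fun x hx => ?_
  · exact Set.infinite_range_of_injective fun a b hab => by simpa using hab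
  · choose n hn using fun v => hx v (Set.mem_univ v)
    have hpos (k : ℕ) : (0 : ℤ) < k + 1 := by positivity
    have h₀ := congrFun h (Interlacing.ofPQ (fun k => n (Sum.inl k) + 1)
      (fun k => n (Sum.inr k) + 1) (fun _ => hpos _) (fun _ => hpos _) m)
    simp only [ActY_PhiPQtoX_ofPQ] at h₀
    have hx' : Sum.elim (fun k => (((n (Sum.inl k) + 1 : ℤ)) : ℂ))
        (fun k => (((n (Sum.inr k) + 1 : ℤ)) : ℂ)) = x := by
      funext v
      rcases v with k | k <;> simp [← hn]
    rw [hx'] at h₀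
    exact h₀

lemma IsSol.ActY_eq_zero {f : PolySeq} (hf : IsSol f) (h : PhiXtoPQ f = 0) : ActY f = 0 := by
  funext x
  obtain ⟨⟨x, m⟩, hx₁, hx₂⟩ := x
  have hx : ∑ j ∈ Finset.range (2 * m + 1), (-1 : ℂ) ^ j * (x j : ℂ) = 0 := by
    exact_mod_cast congrArg (Int.cast : ℤ → ℂ) hx₂
  have h₀ := aeval_PhiXtoPQ hf (aeval (R := ℂ) (Sum.elim
    (fun k => (x (2 * k) : ℂ) - x (2 * k + 1)) (fun k => (x (2 * k + 1) : ℂ) - x (2 * k + 2)))) m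
  simp only [aeval_X, Sum.elim_inl, Sum.elim_inr, h, Pi.zero_apply, map_zero] at h₀
  rw [funext (interlacingCoord_differences (x := fun t => (x t : ℂ)) hx)] at h₀
  exact h₀.symm

lemma IsSol.PhiXtoPQ_sub_eq_zero {f : PolySeq} (hf : IsSol f) :
    PhiXtoPQ (f - PhiPQtoX (PhiXtoPQ f)) = 0 := by
  rw [PhiXtoPQ_sub, hf.isSolPQ_PhiXtoPQ.PhiXtoPQ_PhiPQtoX, sub_self]

/-- `Sol = Im (Φ_{p,q→x}) ⊕ Ker (Φ_{x→p,q})`: every `f ∈ Sol` is uniquely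
`f = Φ_{p,q→x}(h) + k` with `h ∈ Sol'` and `k ∈ Sol` in the kernel of `Φ_{x→p,q}`.
Consequently `ActY ∘ Φ_{p,q→x}` is a vector space isomorphism from `Sol'` onto the image of
`ActY` (the algebra `QΛ` of quasi-symmetric functions on Young diagrams). -/
theorem sol_decomposition_and_iso :
    (∀ f, IsSol f → ∃! hk : PQSeq × PolySeq,
      IsSolPQ hk.1 ∧ IsSol hk.2 ∧ PhiXtoPQ hk.2 = 0 ∧ f = PhiPQtoX hk.1 + hk.2) ∧
    Set.BijOn (fun h => ActY (PhiPQtoX h)) {h | IsSolPQ h} {F | ∃ f, IsSol f ∧ ActY f = F} ∧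
    (∀ h₁ h₂, IsSolPQ h₁ → IsSolPQ h₂ →
      ActY (PhiPQtoX (h₁ + h₂)) = ActY (PhiPQtoX h₁) + ActY (PhiPQtoX h₂)) ∧
    (∀ (c : ℂ) h, IsSolPQ h → ActY (PhiPQtoX (c • h)) = c • ActY (PhiPQtoX h)) := by
  refine ⟨fun f hf => ⟨(PhiXtoPQ f, f - PhiPQtoX (PhiXtoPQ f)), ⟨hf.isSolPQ_PhiXtoPQ,
      hf.sub hf.isSolPQ_PhiXtoPQ.isSol_PhiPQtoX, hf.PhiXtoPQ_sub_eq_zero, by simp⟩, ?_⟩,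
    ⟨fun h hh => ⟨_, hh.isSol_PhiPQtoX, rfl⟩, ActY_PhiPQtoX_injective.injOn, ?_⟩,
    fun h₁ h₂ _ _ => by rw [PhiPQtoX_add, map_add], fun c h _ => by rw [PhiPQtoX_smul, map_smul]⟩
  · rintro ⟨h, k⟩ ⟨hh, -, hk, rfl⟩
    have : PhiXtoPQ (PhiPQtoX h + k) = h := by
      rw [PhiXtoPQ_add, hh.PhiXtoPQ_PhiPQtoX, hk, add_zero]
    simp [this]
  · rintro _ ⟨f, hf, rfl⟩
    refine ⟨PhiXtoPQ f, hf.isSolPQ_PhiXtoPQ, ?_⟩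
    have h := (hf.sub hf.isSolPQ_PhiXtoPQ.isSol_PhiPQtoX).ActY_eq_zero hf.PhiXtoPQ_sub_eq_zero
    rw [map_sub, sub_eq_zero] at h
    exact h.symm
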